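/- With Θ the context-free grammar constructed from a confluent context-free monadic rewriting system (A,R): for all w, u ∈ A*, if w ⇒*_R u then $_u ⇒*_Θ $_w. -/

import Mathlib

/-! Common framework: string rewriting systems and the grammar Θ constructed from a
confluent context-free monadic rewriting system `(A, R)`. -/

/-- Words over the alphabet `A`. -/
abbrev Word (A : Type) : Type := List A

/-- The word (of length at most one) corresponding to an element of `A ∪ {ε}`. -/
def toWord {A : Type} (a : Option A) : Word A := a.elim [] (fun b => [b])

/-- One rewriting step of the string rewriting system `R`. -/
def RWStep {A : Type} (R : Set (Word A × Word A)) (u v : Word A) : Prop :=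
  ∃ (x y l r : Word A), (l, r) ∈ R ∧ u = x ++ l ++ y ∧ v = x ++ r ++ y

/-- The reduction relation `⇒*_R`. -/
abbrev RWDerives {A : Type} (R : Set (Word A × Word A)) : Word A → Word A → Prop :=
  Relation.ReflTransGen (RWStep R)

/-- Equality in the monoid presented by `⟨A | R⟩`. -/
abbrev MonEq {A : Type} (R : Set (Word A × Word A)) : Word A → Word A → Prop :=
  Relation.EqvGen (RWStep R)

/-- Confluence of the rewriting system. -/
def RWConfluent {A : Type} (R : Set (Word A × Word A)) : Prop :=
  ∀ u u' u'' : Word A, RWDerives R u u' → RWDerives R u u'' →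
    ∃ v : Word A, RWDerives R u' v ∧ RWDerives R u'' v

/-- Monadic: length-reducing with right-hand sides in `A ∪ {ε}`. -/
def RWMonadic {A : Type} (R : Set (Word A × Word A)) : Prop :=
  ∀ p ∈ R, p.2.length < p.1.length ∧ p.2.length ≤ 1

/-- Terminal alphabet of the auxiliary grammar `Δ`:
the symbols `$_a`, `$̃_a` (for `a ∈ A ∪ {ε}`) together with `#₂`. -/
inductive DollarT (A : Type) : Type
  | dol : Option A → DollarT A
  | tdol : Option A → DollarT A
  | hash : DollarT A

/-- `$_p` as a word over `DollarT A`: `$_{p₁}⋯$_{p_n}` for `p ≠ ε`,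
and the single letter `$_ε` for `p = ε`. -/
def dW {A : Type} : Word A → List (DollarT A)
  | [] => [DollarT.dol none]
  | p => p.map (fun b => DollarT.dol (some b))

/-- `$̃_p` as a word over `DollarT A`. -/
def tdW {A : Type} : Word A → List (DollarT A)
  | [] => [DollarT.tdol none]
  | p => p.map (fun b => DollarT.tdol (some b))

/-- Nonterminals of `Θ`: the nonterminals of `Δ`, the symbols `$_a` and `$̃_a`
(`a ∈ A ∪ {ε}`), and the (pairwise disjoint) nonterminals of the grammars `Γ'_a`
and `Γ''_a`. -/
inductive ThetaNT (A : Type) (Γ : Option A → ContextFreeGrammar.{0} A)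
    (Δ : ContextFreeGrammar.{0} (DollarT A)) : Type
  | delta : Δ.NT → ThetaNT A Γ Δ
  | dol : Option A → ThetaNT A Γ Δ
  | tdol : Option A → ThetaNT A Γ Δ
  | prime : (a : Option A) → (Γ a).NT → ThetaNT A Γ Δ
  | dprime : (a : Option A) → (Γ a).NT → ThetaNT A Γ Δ

variable {A : Type} (Γ : Option A → ContextFreeGrammar.{0} A)
  (Δ : ContextFreeGrammar.{0} (DollarT A))

/-- Translation of symbols of `Γ_a` into symbols of `Θ`, realising `Γ'_a`:
each terminal `b` is replaced by the nonterminal `$_b`. -/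
def primeSym (a : Option A) : Symbol A (Γ a).NT → Symbol (Option A) (ThetaNT A Γ Δ)
  | Symbol.terminal b => Symbol.nonterminal (ThetaNT.dol (some b))
  | Symbol.nonterminal n => Symbol.nonterminal (ThetaNT.prime a n)

/-- Translation of symbols of `Γ_a` into symbols of `Θ`, realising `Γ''_a`:
each terminal `b` is replaced by the nonterminal `$̃_b`. -/
def dprimeSym (a : Option A) : Symbol A (Γ a).NT → Symbol (Option A) (ThetaNT A Γ Δ)
  | Symbol.terminal b => Symbol.nonterminal (ThetaNT.tdol (some b))
  | Symbol.nonterminal n => Symbol.nonterminal (ThetaNT.dprime a n)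

/-- Translation of symbols of `Δ` into symbols of `Θ`: the terminals `$_a`, `$̃_a`
of `Δ` become nonterminals of `Θ`, and `#₂` stays a terminal (encoded as `none`). -/
def deltaSym : Symbol (DollarT A) Δ.NT → Symbol (Option A) (ThetaNT A Γ Δ)
  | Symbol.terminal (DollarT.dol a) => Symbol.nonterminal (ThetaNT.dol a)
  | Symbol.terminal (DollarT.tdol a) => Symbol.nonterminal (ThetaNT.tdol a)
  | Symbol.terminal DollarT.hash => Symbol.terminal none
  | Symbol.nonterminal n => Symbol.nonterminal (ThetaNT.delta n)

/-- The productions of `Θ`: those of `Δ`, those of all `Γ'_a` and `Γ''_a`, the insertion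
productions `$_a → $_a $_ε`, `$_a → $_ε $_a`, `$̃_a → $̃_a $̃_ε`, `$̃_a → $̃_ε $̃_a`, the
start productions `$_a → O'_a`, `$̃_a → O''_a`, and the terminal productions
`$_a → a`, `$̃_a → a` (with `$_ε → ε`, `$̃_ε → ε`). -/
noncomputable def thetaRules [Fintype A] : List (ContextFreeRule (Option A) (ThetaNT A Γ Δ)) :=
  (Δ.rules.toList.map (fun r =>
    ⟨ThetaNT.delta r.input, r.output.map (deltaSym Γ Δ)⟩))
  ++ ((Finset.univ : Finset (Option A)).toList.flatMap (fun a =>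
      ((Γ a).rules.toList.map (fun r =>
        ⟨ThetaNT.prime a r.input, r.output.map (primeSym Γ Δ a)⟩))
      ++ ((Γ a).rules.toList.map (fun r =>
        ⟨ThetaNT.dprime a r.input, r.output.reverse.map (dprimeSym Γ Δ a)⟩))
      ++ [⟨ThetaNT.dol a, [Symbol.nonterminal (ThetaNT.dol a),
             Symbol.nonterminal (ThetaNT.dol none)]⟩,
          ⟨ThetaNT.dol a, [Symbol.nonterminal (ThetaNT.dol none),
             Symbol.nonterminal (ThetaNT.dol a)]⟩,
          ⟨ThetaNT.tdol a, [Symbol.nonterminal (ThetaNT.tdol a),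
             Symbol.nonterminal (ThetaNT.tdol none)]⟩,
          ⟨ThetaNT.tdol a, [Symbol.nonterminal (ThetaNT.tdol none),
             Symbol.nonterminal (ThetaNT.tdol a)]⟩,
          ⟨ThetaNT.dol a, [Symbol.nonterminal (ThetaNT.prime a (Γ a).initial)]⟩,
          ⟨ThetaNT.tdol a, [Symbol.nonterminal (ThetaNT.dprime a (Γ a).initial)]⟩,
          ⟨ThetaNT.dol a, (toWord a).map (fun b => Symbol.terminal (some b))⟩,
          ⟨ThetaNT.tdol a, (toWord a).map (fun b => Symbol.terminal (some b))⟩]))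

/-- The grammar `Θ`, over the terminal alphabet `A ∪ {#₂}` (encoded as `Option A`
with `none = #₂`), with start symbol `O_Δ`. -/
noncomputable def Theta [Fintype A] : ContextFreeGrammar.{0} (Option A) :=
  { NT := ThetaNT A Γ Δ
    initial := ThetaNT.delta Δ.initial
    rules := @List.toFinset _ (Classical.decEq _) (thetaRules Γ Δ) }

/-- `$_p` as a string of symbols of `Θ` (the single letter `$_ε` when `p = ε`). -/
def dols : Word A → List (Symbol (Option A) (ThetaNT A Γ Δ))
  | [] => [Symbol.nonterminal (ThetaNT.dol none)]
  | p => p.map (fun b => Symbol.nonterminal (ThetaNT.dol (some b)))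

/-- `$̃_p` as a string of symbols of `Θ` (the single letter `$̃_ε` when `p = ε`). -/
def tdols : Word A → List (Symbol (Option A) (ThetaNT A Γ Δ))
  | [] => [Symbol.nonterminal (ThetaNT.tdol none)]
  | p => p.map (fun b => Symbol.nonterminal (ThetaNT.tdol (some b)))

/-- A word over `A` as a string of terminal symbols of `Θ`. -/
def terms : Word A → List (Symbol (Option A) (ThetaNT A Γ Δ)) :=
  fun u => u.map (fun b => Symbol.terminal (some b))

/-- The word `$_{p₁}⋯$_{p_n}`, empty when `p = ε` (unlike `dols`). -/
def dolSyms (p : Word A) : List (Symbol (Option A) (ThetaNT A Γ Δ)) :=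
  p.map (fun b => Symbol.nonterminal (ThetaNT.dol (some b)))

theorem dols_of_ne_nil {p : Word A} (hp : p ≠ []) : dols Γ Δ p = dolSyms Γ Δ p := by
  cases p with
  | nil => exact absurd rfl hp
  | cons b p => rfl

theorem dolSyms_append (p q : Word A) :
    dolSyms Γ Δ (p ++ q) = dolSyms Γ Δ p ++ dolSyms Γ Δ q :=
  List.map_append

section Productions

variable [Fintype A]

theorem theta_produces_of_mem {n : ThetaNT A Γ Δ}
    {o : List (Symbol (Option A) (ThetaNT A Γ Δ))}
    (h : (⟨n, o⟩ : ContextFreeRule (Option A) (ThetaNT A Γ Δ)) ∈ thetaRules Γ Δ)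
    (p q : List (Symbol (Option A) (ThetaNT A Γ Δ)))
    {u v : List (Symbol (Option A) (ThetaNT A Γ Δ))}
    (hu : u = p ++ [Symbol.nonterminal n] ++ q) (hv : v = p ++ o ++ q) :
    (Theta Γ Δ).Produces u v := by
  subst hu hv
  exact ⟨⟨n, o⟩, (@List.mem_toFinset _ (Classical.decEq _) _ _).2 h,
    ContextFreeRule.rewrites_of_exists_parts _ p q⟩

theorem dol_insert_right_mem (a : Option A) :
    (⟨ThetaNT.dol a, [Symbol.nonterminal (ThetaNT.dol a),
      Symbol.nonterminal (ThetaNT.dol none)]⟩ :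
      ContextFreeRule (Option A) (ThetaNT A Γ Δ)) ∈ thetaRules Γ Δ :=
  List.mem_append_right _ (List.mem_flatMap.2 ⟨a, by simp, by simp⟩)

theorem dol_insert_left_mem (a : Option A) :
    (⟨ThetaNT.dol a, [Symbol.nonterminal (ThetaNT.dol none),
      Symbol.nonterminal (ThetaNT.dol a)]⟩ :
      ContextFreeRule (Option A) (ThetaNT A Γ Δ)) ∈ thetaRules Γ Δ :=
  List.mem_append_right _ (List.mem_flatMap.2 ⟨a, by simp, by simp⟩)

theorem dol_start_mem (a : Option A) :
    (⟨ThetaNT.dol a, [Symbol.nonterminal (ThetaNT.prime a (Γ a).initial)]⟩ :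
      ContextFreeRule (Option A) (ThetaNT A Γ Δ)) ∈ thetaRules Γ Δ :=
  List.mem_append_right _ (List.mem_flatMap.2 ⟨a, by simp, by simp⟩)

theorem prime_mem (a : Option A) {r : ContextFreeRule A (Γ a).NT} (hr : r ∈ (Γ a).rules) :
    (⟨ThetaNT.prime a r.input, r.output.map (primeSym Γ Δ a)⟩ :
      ContextFreeRule (Option A) (ThetaNT A Γ Δ)) ∈ thetaRules Γ Δ := by
  refine List.mem_append_right _ (List.mem_flatMap.2 ⟨a, by simp, ?_⟩)
  refine List.mem_append_left _ (List.mem_append_left _ ?_)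
  exact List.mem_map.2 ⟨r, Finset.mem_toList.2 hr, rfl⟩

theorem derives_map_primeSym (a : Option A) {s t : List (Symbol A (Γ a).NT)}
    (h : (Γ a).Derives s t) :
    (Theta Γ Δ).Derives (s.map (primeSym Γ Δ a)) (t.map (primeSym Γ Δ a)) := by
  induction h with
  | refl => exact ContextFreeGrammar.Derives.refl _
  | tail _ h ih =>
    obtain ⟨r, hr, hrw⟩ := h
    obtain ⟨p, q, rfl, rfl⟩ := hrw.exists_parts
    have hmap (o : List (Symbol A (Γ a).NT)) : (p ++ o ++ q).map (primeSym Γ Δ a) =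
        p.map (primeSym Γ Δ a) ++ o.map (primeSym Γ Δ a) ++ q.map (primeSym Γ Δ a) := by
      simp
    exact ih.trans_produces <| theta_produces_of_mem Γ Δ (prime_mem Γ Δ a hr) (p.map (primeSym Γ Δ a))
      (q.map (primeSym Γ Δ a)) (hmap _) (hmap _)

theorem dol_derives_dolSyms (a : Option A) {l : Word A} (hl : l ∈ (Γ a).language) :
    (Theta Γ Δ).Derives [Symbol.nonterminal (ThetaNT.dol a)] (dolSyms Γ Δ l) := by
  have hl' : dolSyms Γ Δ l = (l.map Symbol.terminal).map (primeSym Γ Δ a) := by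
    simp [dolSyms, primeSym]
  rw [hl']
  exact (theta_produces_of_mem Γ Δ (dol_start_mem Γ Δ a) [] [] rfl rfl).trans_derives
    (derives_map_primeSym Γ Δ a (((Γ a).mem_language_iff l).1 hl))

theorem dols_derives_insert (a : Option A) (x y : Word A) :
    (Theta Γ Δ).Derives (dols Γ Δ (x ++ toWord a ++ y))
      (dolSyms Γ Δ x ++ [Symbol.nonterminal (ThetaNT.dol a)] ++ dolSyms Γ Δ y :
        List (Symbol (Option A) (ThetaNT A Γ Δ))) := by
  cases a with
  | some b =>
    rw [dols_of_ne_nil Γ Δ (by simp [toWord]), dolSyms_append, dolSyms_append]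
    exact ContextFreeGrammar.Derives.refl _
  | none =>
    cases y with
    | cons c y =>
      rw [dols_of_ne_nil Γ Δ (by simp)]
      exact (theta_produces_of_mem Γ Δ (dol_insert_left_mem Γ Δ (some c))
        (dolSyms Γ Δ x) (dolSyms Γ Δ y) (by simp [dolSyms, toWord]) (by simp [dolSyms])).single
    | nil =>
      rcases List.eq_nil_or_concat x with rfl | ⟨x, c, rfl⟩
      · exact ContextFreeGrammar.Derives.refl _
      · rw [dols_of_ne_nil Γ Δ (by simp)]
        exact (theta_produces_of_mem Γ Δ (dol_insert_right_mem Γ Δ (some c))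
          (dolSyms Γ Δ x) [] (by simp [dolSyms, toWord]) (by simp [dolSyms])).single

theorem derives_dols_of_mem_language (a : Option A) {l : Word A} (hl : l ∈ (Γ a).language)
    (hne : l ≠ []) (x y : Word A) :
    (Theta Γ Δ).Derives (dols Γ Δ (x ++ toWord a ++ y)) (dols Γ Δ (x ++ l ++ y)) := by
  rw [dols_of_ne_nil Γ Δ (p := x ++ l ++ y) (by simp [hne]), dolSyms_append, dolSyms_append]
  exact (dols_derives_insert Γ Δ a x y).trans
    (((dol_derives_dolSyms Γ Δ a hl).append_left _).append_right _)

end Productions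

theorem exists_eq_toWord {r : Word A} (hr : r.length ≤ 1) : ∃ a : Option A, r = toWord a := by
  match r, hr with
  | [], _ => exact ⟨none, rfl⟩
  | [b], _ => exact ⟨some b, rfl⟩

/-- **Lemma 3.3.** For all `w, u ∈ A*`, if `w ⇒*_R u` then `$_u ⇒*_Θ $_w`. -/
theorem derives_dols_of_rwDerives
    {A : Type} [Fintype A] (R : Set (Word A × Word A))
    (hconf : RWConfluent R) (hmon : RWMonadic R)
    (Γ : Option A → ContextFreeGrammar.{0} A)
    (hΓ : ∀ a : Option A, (Γ a).language = {l : Word A | (l, toWord a) ∈ R})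
    (hΓeps : ∀ a : Option A, ∀ r ∈ (Γ a).rules, r.output ≠ [])
    (Δ : ContextFreeGrammar.{0} (DollarT A))
    (hΔ : Δ.language =
      {x | ∃ p : Word A, x = dW p ++ [DollarT.hash] ++ tdW p.reverse}) :
    ∀ w u : Word A, RWDerives R w u →
      (Theta Γ Δ).Derives (dols Γ Δ u) (dols Γ Δ w) := by
  intro w u h
  induction h with
  | refl => exact ContextFreeGrammar.Derives.refl _
  | tail _ hstep ih =>
    obtain ⟨x, y, l, r, hlr, rfl, rfl⟩ := hstep
    obtain ⟨hlt, hle⟩ := hmon _ hlr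
    obtain ⟨a, rfl⟩ := exists_eq_toWord hle
    have hl : l ∈ (Γ a).language := by
      rw [hΓ a]
      exact hlr
    have hne : l ≠ [] := by
      rintro rfl
      simp at hlt
    exact (derives_dols_of_mem_language Γ Δ a hl hne x y).trans ih
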